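/- Let (w,α) ∈ S_{λ,μ} and let i, j with |i−j| > 1 be such that k_i := ⟨w(λ+ρ), α_i^∨⟩ < 0, k_j := ⟨w(λ+ρ), α_j^∨⟩ < 0, f_i^{−k_i}(α) ≠ 0 and f_j^{−k_j}(α) ≠ 0. Then f_i^{−k_i}(f_j^{−k_j}(α)) = f_j^{−k_j}(f_i^{−k_i}(α)) ≠ 0. -/

import Mathlib

open scoped BigOperators

namespace KFC

/-- A (candidate) root is a pair of 1-based indices. -/
abbrev Root : Type := ℕ × ℕ

/-- A Kostant partition is encoded as a multiplicity function on pairs. -/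
abbrev KPf : Type := Root → ℕ

/-- An entry of a signed word: a sign (`true` = '+', `false` = '−') together
with the root lying under it. -/
abbrev Entry : Type := Bool × Root

/-- `p` is a positive root of type `A_{n-1}`. -/
def IsPos (n : ℕ) (p : Root) : Prop := 1 ≤ p.1 ∧ p.1 < p.2 ∧ p.2 ≤ n

/-- `α` is a genuine Kostant partition for type `A_{n-1}`: it is supported on
positive roots. -/
def IsKP (n : ℕ) (α : KPf) : Prop := ∀ p, α p ≠ 0 → IsPos n p

/-- Add one copy of the root `r`. -/
def KPadd (α : KPf) (r : Root) : KPf := fun p => if p = r then α p + 1 else α p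

/-- Remove one copy of the root `r`. -/
def KPsub (α : KPf) (r : Root) : KPf := fun p => if p = r then α p - 1 else α p

/-- Replace one copy of `r` by one copy of `r'`. -/
def KPmove (α : KPf) (r r' : Root) : KPf := KPadd (KPsub α r) r'

/-- The signed word `W_i` of `α`: roots `(a,b)` ordered by decreasing `a` and,
for equal `a`, increasing `b`; a '+' under each `(h,i)` and a '−' under each
`(h,i+1)`. -/
def Wword (n i : ℕ) (α : KPf) : List Entry :=
  ((List.range (n+1)).reverse).flatMap (fun h =>
    List.replicate (α (h, i)) ((true, (h, i)) : Entry) ++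
    List.replicate (α (h, i+1)) ((false, (h, i+1)) : Entry))

/-- The signed word `W_i*` of `α`: roots `(a,b)` ordered by increasing `b` and,
for equal `b`, decreasing `a`; a '+' under each `(i+1,j)` and a '−' under each
`(i,j)`. -/
def Wstar (n i : ℕ) (α : KPf) : List Entry :=
  (List.range (n+1)).flatMap (fun j =>
    List.replicate (α (i+1, j)) ((true, (i+1, j)) : Entry) ++
    List.replicate (α (i, j)) ((false, (i, j)) : Entry))

/-- One step of the left-to-right reduction: a new '+' cancels the rightmost
surviving '−' (the surviving word always has the shape `+^a −^b`). -/
def redStep (s : List Entry) (e : Entry) : List Entry :=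
  match e.1, s.getLast? with
  | true, some (false, _) => s.dropLast
  | _, _ => s ++ [e]

/-- The reduced word (list of surviving entries, in order). -/
def reduceW (w : List Entry) : List Entry := w.foldl redStep []

def plusCt (w : List Entry) : ℕ := (w.filter (fun e => e.1)).length
def minusCt (w : List Entry) : ℕ := (w.filter (fun e => !e.1)).length

/-- `a_i`: number of '+' in the reduced word of `W_i`. -/
def aSt (n i : ℕ) (α : KPf) : ℕ := plusCt (reduceW (Wword n i α))
/-- `b_i`: number of '−' in the reduced word of `W_i`. -/
def bSt (n i : ℕ) (α : KPf) : ℕ := minusCt (reduceW (Wword n i α))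
/-- `a_i*`. -/
def aStar (n i : ℕ) (α : KPf) : ℕ := plusCt (reduceW (Wstar n i α))
/-- `b_i*`. -/
def bStar (n i : ℕ) (α : KPf) : ℕ := minusCt (reduceW (Wstar n i α))
/-- `u_i`: number of '+' in the reduced word of `W_i* W_i`. -/
def uSt (n i : ℕ) (α : KPf) : ℕ := plusCt (reduceW (Wstar n i α ++ Wword n i α))
/-- `v_i`: number of '−' in the reduced word of `W_i* W_i`. -/
def vSt (n i : ℕ) (α : KPf) : ℕ := minusCt (reduceW (Wstar n i α ++ Wword n i α))

/-- The root under the rightmost surviving '+'. -/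
def lastPlus (w : List Entry) : Option Root :=
  (((reduceW w).filter (fun e => e.1)).getLast?).map Prod.snd

/-- The root under the leftmost surviving '−'. -/
def headMinus (w : List Entry) : Option Root :=
  (((reduceW w).filter (fun e => !e.1)).head?).map Prod.snd

/-- The operator `f̃_i`. -/
def ftilde (n i : ℕ) (α : KPf) : Option KPf :=
  match lastPlus (Wword n i α) with
  | some r => some (KPmove α r (r.1, i+1))
  | none => some (KPadd α (i, i+1))

/-- The operator `ẽ_i`. -/
def etilde (n i : ℕ) (α : KPf) : Option KPf :=
  match headMinus (Wword n i α) with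
  | some r => if r = (i, i+1) then some (KPsub α (i, i+1)) else some (KPmove α r (r.1, i))
  | none => none

/-- The operator `f̃_i*`. -/
def ftildeS (n i : ℕ) (α : KPf) : Option KPf :=
  match lastPlus (Wstar n i α) with
  | some r => some (KPmove α r (i, r.2))
  | none => some (KPadd α (i, i+1))

/-- The operator `ẽ_i*`. -/
def etildeS (n i : ℕ) (α : KPf) : Option KPf :=
  match headMinus (Wstar n i α) with
  | some r => if r = (i, i+1) then some (KPsub α (i, i+1)) else some (KPmove α r (i+1, r.2))
  | none => none

/-- The modified operator `f_i`. -/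
def fop (n i : ℕ) (α : KPf) : Option KPf :=
  if bStar n i α < aSt n i α then ftilde n i α
  else if 0 < aStar n i α then ftildeS n i α
  else none

/-- The modified operator `e_i`. -/
def eop (n i : ℕ) (α : KPf) : Option KPf :=
  if bStar n i α ≤ aSt n i α then
    (if 0 < bSt n i α ∧ headMinus (Wword n i α) ≠ some (i, i+1) then etilde n i α else none)
  else
    (if headMinus (Wstar n i α) ≠ some (i, i+1) then etildeS n i α else none)

/-- The operator `ê_i`. -/
def ehat (n i : ℕ) (α : KPf) : Option KPf :=
  if bStar n i α ≤ aSt n i α then (if 0 < bSt n i α then etilde n i α else none)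
  else etildeS n i α

/-- Iterate a partially defined operator (`none` plays the role of `0`). -/
def iterO (g : KPf → Option KPf) : ℕ → KPf → Option KPf
  | 0, x => some x
  | k+1, x => (g x).bind (iterO g k)

/-- `ε_i(x) = max {k : e_i^k x ≠ 0}`. -/
noncomputable def epsS (n i : ℕ) (x : KPf) : ℕ := sSup {k | iterO (eop n i) k x ≠ none}
/-- `ε̂_i(x) = max {k : ê_i^k x ≠ 0}`. -/
noncomputable def epsHatS (n i : ℕ) (x : KPf) : ℕ := sSup {k | iterO (ehat n i) k x ≠ none}
/-- `φ_i(x) = max {k : f_i^k x ≠ 0}`. -/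
noncomputable def phiS (n i : ℕ) (x : KPf) : ℕ := sSup {k | iterO (fop n i) k x ≠ none}

noncomputable def epsO (n i : ℕ) (o : Option KPf) : ℕ := o.elim 0 (epsS n i)
noncomputable def epsHatO (n i : ℕ) (o : Option KPf) : ℕ := o.elim 0 (epsHatS n i)
noncomputable def phiO (n i : ℕ) (o : Option KPf) : ℕ := o.elim 0 (phiS n i)

/-- `e_l(γ) ≃ 0`. -/
def simZero (n l : ℕ) (γ : KPf) : Prop := eop n l γ ≠ ehat n l γ

/-- `e_l e_m (γ) ≃ 0`. -/
def simZero2 (n l m : ℕ) (γ : KPf) : Prop := ∃ δ, eop n m γ = some δ ∧ simZero n l δ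

/-- The box containing all relevant pairs. -/
def kbox (n : ℕ) : Finset (ℕ × ℕ) := Finset.range (n+1) ×ˢ Finset.range (n+1)

/-- `|α|`: number of parts of the Kostant partition. -/
def kpSize (n : ℕ) (α : KPf) : ℕ := ∑ p ∈ kbox n, α p

/-- The evaluation `ᾱ ∈ ℤ^n` (as a function on 1-based coordinates). -/
def kpEval (n : ℕ) (α : KPf) : ℕ → ℤ :=
  fun k => ∑ p ∈ kbox n, (α p : ℤ) * ((if p.1 = k then 1 else 0) - (if p.2 = k then 1 else 0))

/-- The simple root `α_i = ε_i − ε_{i+1}` as a vector. -/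
def srVec (i : ℕ) : ℕ → ℤ := fun k => (if k = i then 1 else 0) - (if k = i+1 then 1 else 0)

/-- `ρ = (n-1, n-2, …, 1, 0)` (on 1-based coordinates `1..n`). -/
def rhoVec (n : ℕ) : ℕ → ℤ := fun k => (n : ℤ) - k

/-- `⟨γ, α_i^∨⟩ = γ_i − γ_{i+1}`. -/
def pairCo (γ : ℕ → ℤ) (i : ℕ) : ℤ := γ i - γ (i+1)

/-- The permutation of 1-based coordinates induced by `w : Perm (Fin n)`. -/
def extP (n : ℕ) (w : Equiv.Perm (Fin n)) (k : ℕ) : ℕ :=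
  if h : 1 ≤ k ∧ k ≤ n then ((w ⟨k - 1, by omega⟩ : Fin n) : ℕ) + 1 else k

/-- `S_n` acting on `ℤ^n` by permuting coordinates: `(w·v)_k = v_{w⁻¹(k)}`. -/
def permAct (n : ℕ) (w : Equiv.Perm (Fin n)) (v : ℕ → ℤ) : ℕ → ℤ :=
  fun k => v (extP n w⁻¹ k)

/-- The simple transposition `s_i = (i, i+1)` (1-based). -/
def sT (n i : ℕ) : Equiv.Perm (Fin n) :=
  if h : 1 ≤ i ∧ i < n then Equiv.swap ⟨i - 1, by omega⟩ ⟨i, h.2⟩ else 1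

/-- Coxeter length = number of inversions. -/
def lenP (n : ℕ) (w : Equiv.Perm (Fin n)) : ℕ :=
  (Finset.univ.filter (fun p : Fin n × Fin n => p.1 < p.2 ∧ w p.2 < w p.1)).card

/-- The left weak Bruhat order: `u ≤ w` iff `ℓ(w) = ℓ(w u⁻¹) + ℓ(u)`. -/
def leftWeakLE (n : ℕ) (u w : Equiv.Perm (Fin n)) : Prop :=
  lenP n w = lenP n (w * u⁻¹) + lenP n u

/-- `λ + ρ` as a vector. -/
def lamRho (n : ℕ) (lam : ℕ → ℤ) : ℕ → ℤ := fun k => lam k + rhoVec n k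

/-- `(w, α) ∈ S_{λ,μ}`, i.e. `ᾱ = w(λ+ρ) − (μ+ρ)`. -/
def InS (n : ℕ) (lam mu : ℕ → ℤ) (w : Equiv.Perm (Fin n)) (α : KPf) : Prop :=
  IsKP n α ∧ ∀ k, 1 ≤ k → k ≤ n →
    kpEval n α k = permAct n w (lamRho n lam) k - (mu k + rhoVec n k)

/-- A directed edge `(w,α) →^i (s_i w, β)` of the `Φ`-graph. -/
def PhiEdge (n : ℕ) (lam mu : ℕ → ℤ) (v v' : Equiv.Perm (Fin n) × KPf) : Prop :=
  InS n lam mu v.1 v.2 ∧ InS n lam mu v'.1 v'.2 ∧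
  ∃ i, 1 ≤ i ∧ i ≤ n - 1 ∧
    pairCo (permAct n v.1 (lamRho n lam)) i < 0 ∧
    v'.1 = sT n i * v.1 ∧
    iterO (fop n i) (-(pairCo (permAct n v.1 (lamRho n lam)) i)).toNat v.2 = some v'.2

/-- Being in the same connected component of (the underlying undirected graph of)
the `Φ`-graph. -/
def Conn (n : ℕ) (lam mu : ℕ → ℤ) (v v' : Equiv.Perm (Fin n) × KPf) : Prop :=
  Relation.ReflTransGen (fun a b => PhiEdge n lam mu a b ∨ PhiEdge n lam mu b a) v v'

/-- `(w,β)` has a broken hexagon, broken by `Φ_i` after `Φ_j`. -/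
def BrokenHexAt (n : ℕ) (lam mu : ℕ → ℤ) (w : Equiv.Perm (Fin n)) (β : KPf) (i j : ℕ) : Prop :=
  (j = i + 1 ∨ i = j + 1) ∧ 1 ≤ i ∧ i ≤ n - 1 ∧ 1 ≤ j ∧ j ≤ n - 1 ∧
  0 < pairCo (permAct n w (lamRho n lam)) i ∧
  0 < pairCo (permAct n w (lamRho n lam)) j ∧
  iterO (eop n i) (pairCo (permAct n w (lamRho n lam)) i).toNat β ≠ none ∧
  ∃ δ, iterO (eop n j) (pairCo (permAct n w (lamRho n lam)) j).toNat β = some δ ∧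
    epsS n i δ < (pairCo (permAct n w (lamRho n lam)) i).toNat +
      (pairCo (permAct n w (lamRho n lam)) j).toNat

/-- `γ` is obtained from `β` by an initial segment of the operator sequence
(`e_i` applied `ki` times, then `e_j` applied `ki+kj` times, then `e_i` applied
`kj` times). -/
def alongPath (n i j ki kj : ℕ) (β γ : KPf) : Prop :=
  (∃ a ≤ ki, iterO (eop n i) a β = some γ) ∨
  (∃ b ≤ ki + kj, (iterO (eop n i) ki β).bind (iterO (eop n j) b) = some γ) ∨
  (∃ c ≤ kj, ((iterO (eop n i) ki β).bind (iterO (eop n j) (ki + kj))).bind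
      (iterO (eop n i) c) = some γ)

/-- Conjecture A: no broken diamonds along the hexagon paths. -/
def ConjA (n : ℕ) (lam mu : ℕ → ℤ) : Prop :=
  ∀ (w : Equiv.Perm (Fin n)) (β : KPf) (i j : ℕ),
    InS n lam mu w β → 1 ≤ i → i ≤ n - 1 → 1 ≤ j → j ≤ n - 1 → (j = i + 1 ∨ i = j + 1) →
    ∀ ki kj : ℤ,
      ki = pairCo (permAct n w (lamRho n lam)) i →
      kj = pairCo (permAct n w (lamRho n lam)) j →
      0 < ki → 0 < kj →
      iterO (eop n i) ki.toNat β ≠ none → iterO (eop n j) kj.toNat β ≠ none →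
      ∀ γ : KPf,
        (alongPath n i j ki.toNat kj.toNat β γ ∨ alongPath n j i kj.toNat ki.toNat β γ) →
        ¬ (simZero2 n i j γ ∧ simZero2 n j i γ)

/-- Conjecture B: broken hexagons propagate up to the source vertex. -/
def ConjB (n : ℕ) (lam mu : ℕ → ℤ) : Prop :=
  ∀ (w : Equiv.Perm (Fin n)) (β α : KPf) (i j : ℕ),
    InS n lam mu w β → InS n lam mu 1 α → Conn n lam mu (1, α) (w, β) →
    BrokenHexAt n lam mu w β i j → ∃ j', BrokenHexAt n lam mu 1 α i j'

/-- The Kostka–Foulkes polynomial `K_{λ,μ}(t) = Σ_{(w,α) ∈ S_{λ,μ}} sgn(w) t^{|α|}`. -/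
noncomputable def KF (n : ℕ) (lam mu : ℕ → ℤ) : Polynomial ℤ :=
  ∑ᶠ (w : Equiv.Perm (Fin n)) (α : KPf) (_ : InS n lam mu w α),
    ((Equiv.Perm.sign w : ℤ) • (Polynomial.X ^ kpSize n α) : Polynomial ℤ)

end KFC


namespace KFC

/-- Summary of a reduced word: the numbers of surviving '+' and '−', and the key (row or column
index) of the rightmost surviving '+'. -/
structure WState where
  plus : ℕ
  minus : ℕ
  last : Option ℕ

/-- Effect of appending `P h` copies of '+' and then `M h` copies of '−', all with key `h`. -/
def WState.step (P M : ℕ → ℕ) (t : WState) (h : ℕ) : WState :=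
  if t.minus < P h then ⟨t.plus + (P h - t.minus), M h, some h⟩
  else ⟨t.plus, t.minus - P h + M h, t.last⟩

/-- The summary of the empty word. -/
def WState.init : WState := ⟨0, 0, none⟩

/-- The word `s` is reduced and is summarized by `t`, where `root` turns keys into roots. -/
def Represents (root : ℕ → Root) (s : List Entry) (t : WState) : Prop :=
  ∃ pl mi : List Entry, s = pl ++ mi ∧ (∀ e ∈ pl, e.1 = true) ∧ (∀ e ∈ mi, e.1 = false) ∧
    pl.length = t.plus ∧ mi.length = t.minus ∧ pl.getLast?.map Prod.snd = t.last.map root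

theorem Represents.redStep_minus {root : ℕ → Root} {s : List Entry} {t : WState}
    (H : Represents root s t) (r : Root) :
    Represents root (redStep s (false, r)) ⟨t.plus, t.minus + 1, t.last⟩ := by
  obtain ⟨pl, mi, rfl, hp, hm, h1, h2, h3⟩ := H
  refine ⟨pl, mi ++ [(false, r)], by simp [redStep], hp, ?_, h1, by simp [h2], h3⟩
  intro e he
  rcases List.mem_append.1 he with he | he
  · exact hm e he
  · simp at he; simp [he]

theorem Represents.redStep_plus {root : ℕ → Root} {s : List Entry} {t : WState}
    (H : Represents root s t) (h : ℕ) :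
    Represents root (redStep s (true, root h))
      (if t.minus = 0 then ⟨t.plus + 1, 0, some h⟩ else ⟨t.plus, t.minus - 1, t.last⟩) := by
  obtain ⟨pl, mi, rfl, hp, hm, h1, h2, h3⟩ := H
  rcases List.eq_nil_or_concat mi with rfl | ⟨mi, e, rfl⟩
  · have h0 : t.minus = 0 := by simpa using h2.symm
    rw [if_pos h0]
    refine ⟨pl ++ [(true, root h)], [], ?_, ?_, by simp, by simp [h1], by simp, by simp⟩
    · rcases List.eq_nil_or_concat pl with rfl | ⟨pl, e, rfl⟩
      · simp [redStep]
      · have := hp e (by simp)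
        obtain ⟨b, r⟩ := e
        simp only at this
        subst this
        simp [redStep]
    · intro e he
      rcases List.mem_append.1 he with he | he
      · exact hp e he
      · simp at he; simp [he]
  · have h0 : t.minus ≠ 0 := by simp at h2; omega
    rw [if_neg h0]
    have := hm e (by simp)
    obtain ⟨b, r⟩ := e
    simp only at this
    subst this
    refine ⟨pl, mi, ?_, hp, fun e he => hm e (by simp [he]), h1, ?_, h3⟩
    · simp [redStep, ← List.append_assoc]
    · simp at h2 ⊢; omega

theorem Represents.foldl_replicate_minus {root : ℕ → Root} (r : Root) (y : ℕ) :
    ∀ {s : List Entry} {t : WState}, Represents root s t →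
      Represents root ((List.replicate y ((false, r) : Entry)).foldl redStep s)
        ⟨t.plus, t.minus + y, t.last⟩ := by
  induction y with
  | zero => intro s t H; simpa using H
  | succ y ih =>
    intro s t H
    have := ih (H.redStep_minus r)
    simp only [List.replicate_succ, List.foldl_cons]
    rwa [Nat.add_assoc, Nat.add_comm 1 y] at this

theorem Represents.foldl_replicate_plus {root : ℕ → Root} (h x : ℕ) :
    ∀ {s : List Entry} {t : WState}, Represents root s t →
      Represents root ((List.replicate x ((true, root h) : Entry)).foldl redStep s)
        (if t.minus < x then ⟨t.plus + (x - t.minus), 0, some h⟩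
          else ⟨t.plus, t.minus - x, t.last⟩) := by
  induction x with
  | zero => intro s t H; simpa using H
  | succ x ih =>
    intro s t H
    have := ih (H.redStep_plus h)
    simp only [List.replicate_succ, List.foldl_cons]
    convert this using 1
    split_ifs <;> simp_all <;> omega

theorem Represents.step {root : ℕ → Root} {s : List Entry} {t : WState}
    (H : Represents root s t) (P M : ℕ → ℕ) (root' : ℕ → Root) (h : ℕ) :
    Represents root ((List.replicate (P h) ((true, root h) : Entry) ++
      List.replicate (M h) ((false, root' h) : Entry)).foldl redStep s) (t.step P M h) := by
  rw [List.foldl_append]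
  have := (H.foldl_replicate_plus h (P h)).foldl_replicate_minus (root' h) (M h)
  convert this using 1
  unfold WState.step
  split_ifs <;> simp

theorem represents_foldl (P M : ℕ → ℕ) (root root' : ℕ → Root) (L : List ℕ) :
    ∀ {s : List Entry} {t : WState}, Represents root s t →
      Represents root ((L.flatMap fun h => List.replicate (P h) ((true, root h) : Entry) ++
        List.replicate (M h) ((false, root' h) : Entry)).foldl redStep s)
        (L.foldl (WState.step P M) t) := by
  induction L with
  | nil => intro s t H; simpa using H
  | cons h L ih =>
    intro s t H
    rw [List.flatMap_cons, List.foldl_append, List.foldl_cons]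
    exact ih (H.step P M root' h)

theorem represents_init (root : ℕ → Root) : Represents root [] WState.init :=
  ⟨[], [], by simp [WState.init]⟩

theorem Represents.plusCt_eq {root : ℕ → Root} {s : List Entry} {t : WState}
    (H : Represents root s t) : plusCt s = t.plus := by
  obtain ⟨pl, mi, rfl, hp, hm, h1, h2, h3⟩ := H
  have e1 : pl.filter (fun e => e.1) = pl := List.filter_eq_self.2 hp
  have e2 : mi.filter (fun e => e.1) = [] := List.filter_eq_nil_iff.2 fun e he => by simp [hm e he]
  rw [plusCt, List.filter_append, e1, e2, List.append_nil, h1]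

theorem Represents.minusCt_eq {root : ℕ → Root} {s : List Entry} {t : WState}
    (H : Represents root s t) : minusCt s = t.minus := by
  obtain ⟨pl, mi, rfl, hp, hm, h1, h2, h3⟩ := H
  have e1 : pl.filter (fun e => !e.1) = [] := List.filter_eq_nil_iff.2 fun e he => by simp [hp e he]
  have e2 : mi.filter (fun e => !e.1) = mi := List.filter_eq_self.2 fun e he => by simp [hm e he]
  rw [minusCt, List.filter_append, e1, e2, List.nil_append, h2]

theorem Represents.lastPlus_eq {root : ℕ → Root} {w : List Entry} {t : WState}
    (H : Represents root (reduceW w) t) : lastPlus w = t.last.map root := by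
  obtain ⟨pl, mi, hs, hp, hm, h1, h2, h3⟩ := H
  have e1 : pl.filter (fun e => e.1) = pl := List.filter_eq_self.2 hp
  have e2 : mi.filter (fun e => e.1) = [] := List.filter_eq_nil_iff.2 fun e he => by simp [hm e he]
  rw [lastPlus, hs, List.filter_append, e1, e2, List.append_nil, h3]

theorem Represents.last_ne_none {root : ℕ → Root} {s : List Entry} {t : WState}
    (H : Represents root s t) (h0 : 0 < t.plus) : t.last ≠ none := by
  obtain ⟨pl, mi, rfl, hp, hm, h1, h2, h3⟩ := H
  intro hn
  simp [hn] at h3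
  simp [h3] at h1
  omega

theorem Represents.plus_pos {root : ℕ → Root} {s : List Entry} {t : WState}
    (H : Represents root s t) {h : ℕ} (h0 : t.last = some h) : 0 < t.plus := by
  obtain ⟨pl, mi, rfl, hp, hm, h1, h2, h3⟩ := H
  rw [← h1, List.length_pos_iff]
  rintro rfl
  simp [h0] at h3

/-- The summary of `W_i`, keyed by rows. -/
def wState (n i : ℕ) (α : KPf) : WState :=
  ((List.range (n+1)).reverse).foldl
    (WState.step (fun h => α (h, i)) (fun h => α (h, i+1))) WState.init

/-- The summary of `W_i*`, keyed by columns. -/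
def wStateS (n i : ℕ) (α : KPf) : WState :=
  (List.range (n+1)).foldl
    (WState.step (fun m => α (i+1, m)) (fun m => α (i, m))) WState.init

theorem represents_Wword (n i : ℕ) (α : KPf) :
    Represents (fun h => (h, i)) (reduceW (Wword n i α)) (wState n i α) :=
  represents_foldl (fun h => α (h, i)) (fun h => α (h, i+1)) (fun h => (h, i))
    (fun h => (h, i+1)) _ (represents_init _)

theorem represents_Wstar (n i : ℕ) (α : KPf) :
    Represents (fun m => (i+1, m)) (reduceW (Wstar n i α)) (wStateS n i α) :=
  represents_foldl (fun m => α (i+1, m)) (fun m => α (i, m)) (fun m => (i+1, m))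
    (fun m => (i, m)) _ (represents_init _)

/-- `f_i` described through the summaries of `W_i` and `W_i*`. -/
theorem fop_eq_some_iff (n i : ℕ) (α β : KPf) :
    fop n i α = some β ↔
      ((wStateS n i α).minus < (wState n i α).plus ∧
        ∃ h, (wState n i α).last = some h ∧ β = KPmove α (h, i) (h, i+1)) ∨
      ((wState n i α).plus ≤ (wStateS n i α).minus ∧
        ∃ m, (wStateS n i α).last = some m ∧ β = KPmove α (i+1, m) (i, m)) := by
  have HW := represents_Wword n i α
  have HS := represents_Wstar n i α
  unfold fop ftilde ftildeS
  rw [bStar, aSt, aStar, HW.plusCt_eq, HS.minusCt_eq, HS.plusCt_eq, HW.lastPlus_eq,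
    HS.lastPlus_eq]
  by_cases hc : (wStateS n i α).minus < (wState n i α).plus
  · obtain ⟨h, hh⟩ := Option.ne_none_iff_exists'.1 (HW.last_ne_none (by omega))
    simp [hc, hh, eq_comm]
  · by_cases hp : 0 < (wStateS n i α).plus
    · obtain ⟨m, hm⟩ := Option.ne_none_iff_exists'.1 (HS.last_ne_none hp)
      simp [hc, hp, hm, eq_comm, not_lt.1 hc]
    · have : ∀ m, (wStateS n i α).last ≠ some m := fun m hm => hp (HS.plus_pos hm)
      simp [hc, hp, this]

theorem foldl_step_congr {P M P' M' : ℕ → ℕ} {L : List ℕ}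
    (hP : ∀ h ∈ L, P h = P' h) (hM : ∀ h ∈ L, M h = M' h) (t : WState) :
    L.foldl (WState.step P M) t = L.foldl (WState.step P' M') t := by
  refine List.foldl_ext _ _ _ fun t h hh => ?_
  rw [WState.step, WState.step, hP h hh, hM h hh]

theorem foldl_step_last (P M : ℕ → ℕ) (L : List ℕ) :
    ∀ (t : WState) (h : ℕ), (L.foldl (WState.step P M) t).last = some h →
      (h ∈ L ∧ 0 < P h) ∨ t.last = some h := by
  induction L with
  | nil => intro t h H; exact Or.inr H
  | cons k L ih =>
    intro t h H
    rcases ih _ _ H with ⟨h1, h2⟩ | h1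
    · exact Or.inl ⟨List.mem_cons_of_mem _ h1, h2⟩
    · unfold WState.step at h1
      split_ifs at h1 with hk
      · simp only [Option.some.injEq] at h1
        subst h1
        exact Or.inl ⟨by simp, by omega⟩
      · exact Or.inr h1

/-- Two runs from summaries with the same counts keep the same counts, and their last keys
agree as soon as one more '+' survives. -/
theorem foldl_step_of_counts_eq (P M : ℕ → ℕ) (L : List ℕ) :
    ∀ (t t' : WState), t.plus = t'.plus → t.minus = t'.minus →
      (L.foldl (WState.step P M) t).plus = (L.foldl (WState.step P M) t').plus ∧
      (L.foldl (WState.step P M) t).minus = (L.foldl (WState.step P M) t').minus ∧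
      (((L.foldl (WState.step P M) t).last = (L.foldl (WState.step P M) t').last ∧
          ∃ h ∈ L, (L.foldl (WState.step P M) t).last = some h) ∨
        ((L.foldl (WState.step P M) t).last = t.last ∧
          (L.foldl (WState.step P M) t').last = t'.last)) := by
  induction L with
  | nil => intro t t' h1 h2; simp [h1, h2]
  | cons k L ih =>
    rintro ⟨a, b, l⟩ ⟨a', b', l'⟩ h1 h2
    simp only at h1 h2
    subst h1 h2
    simp only [List.foldl_cons]
    by_cases hk : b < P k
    · have e : ∀ l, WState.step P M ⟨a, b, l⟩ k = ⟨a + (P k - b), M k, some k⟩ := fun l => by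
        simp [WState.step, hk]
      rw [e, e]
      refine ⟨rfl, rfl, Or.inl ⟨rfl, ?_⟩⟩
      obtain ⟨-, -, ⟨-, h, hh, hl⟩ | ⟨hl, -⟩⟩ := ih ⟨a + (P k - b), M k, some k⟩ _ rfl rfl
      · exact ⟨h, List.mem_cons_of_mem _ hh, hl⟩
      · exact ⟨k, by simp, hl⟩
    · have e : ∀ l, WState.step P M ⟨a, b, l⟩ k = ⟨a, b - P k + M k, l⟩ := fun l => by
        simp [WState.step, hk]
      rw [e, e]
      obtain ⟨e1, e2, ⟨e3, h, hh, hl⟩ | e3⟩ :=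
        ih ⟨a, b - P k + M k, l⟩ ⟨a, b - P k + M k, l'⟩ rfl rfl
      · exact ⟨e1, e2, Or.inl ⟨e3, h, List.mem_cons_of_mem _ hh, hl⟩⟩
      · exact ⟨e1, e2, Or.inr e3⟩

/-- Two consecutive blocks `+^p −^q +^r −^s` act as the single block obtained by reduction. -/
theorem step_step (P M : ℕ → ℕ) (u v : ℕ) (t : WState) :
    (t.step P M u).step P M v =
      ⟨t.plus + (P u + (P v - M u) - t.minus),
        (t.minus - (P u + (P v - M u))) + ((M u - P v) + M v),
        if t.minus < P u + (P v - M u) then some (if M u < P v then v else u) else t.last⟩ := by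
  unfold WState.step
  by_cases h1 : t.minus < P u <;> by_cases h2 : M u < P v
  · have : t.minus < P u + (P v - M u) := by omega
    simp [h1, h2, this]; omega
  · have : t.minus < P u + (P v - M u) := by omega
    simp [h1, h2, this]; omega
  · by_cases h3 : t.minus < P u + (P v - M u)
    · have : t.minus - P u + M u < P v := by omega
      simp [h1, h2, h3, this]; omega
    · have : ¬ t.minus - P u + M u < P v := by omega
      simp [h1, h3, this]; omega
  · have h3 : ¬ t.minus < P u + (P v - M u) := by omega
    have : ¬ t.minus - P u + M u < P v := by omega
    simp [h1, h3, this]; omega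

/-- A list in which `u` and `v` occur exactly once, consecutively and in this order. -/
def Consecutive (u v : ℕ) (L : List ℕ) : Prop :=
  ∃ L₁ L₂ : List ℕ, L = L₁ ++ u :: v :: L₂ ∧ u ∉ L₁ ∧ v ∉ L₁ ∧ u ∉ L₂ ∧ v ∉ L₂

theorem Consecutive.reverse {u v : ℕ} {L : List ℕ} (H : Consecutive u v L) :
    Consecutive v u L.reverse := by
  obtain ⟨L₁, L₂, rfl, h1, h2, h3, h4⟩ := H
  exact ⟨L₂.reverse, L₁.reverse, by simp, by simpa, by simpa, by simpa, by simpa⟩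

theorem consecutive_range {u N : ℕ} (h : u + 1 < N) : Consecutive u (u+1) (List.range N) := by
  obtain ⟨k, rfl⟩ : ∃ k, N = u + (2 + k) := ⟨N - (u + 2), by omega⟩
  refine ⟨List.range u, List.range' (u+2) k, ?_, by simp, by simp, by simp, by simp⟩
  rw [List.range_eq_range', List.range_eq_range', ← List.range'_append_1, Nat.zero_add,
    ← List.range'_append_1]
  rfl

/-- Changing the multiplicities at two consecutive keys without changing the reduction of their
blocks. -/
theorem Consecutive.foldl_step {u v : ℕ} {L : List ℕ} (H : Consecutive u v L)
    {P M P' M' : ℕ → ℕ} (hP : ∀ h, h ≠ u → h ≠ v → P h = P' h)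
    (hM : ∀ h, h ≠ u → h ≠ v → M h = M' h)
    (hA : P u + (P v - M u) = P' u + (P' v - M' u))
    (hB : (M u - P v) + M v = (M' u - P' v) + M' v) :
    (L.foldl (WState.step P M) WState.init).plus =
        (L.foldl (WState.step P' M') WState.init).plus ∧
      (L.foldl (WState.step P M) WState.init).minus =
        (L.foldl (WState.step P' M') WState.init).minus ∧
      (((L.foldl (WState.step P M) WState.init).last =
          (L.foldl (WState.step P' M') WState.init).last ∧
          (L.foldl (WState.step P M) WState.init).last ≠ some u ∧
          (L.foldl (WState.step P M) WState.init).last ≠ some v) ∨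
        ((L.foldl (WState.step P M) WState.init).last = some (if M u < P v then v else u) ∧
          (L.foldl (WState.step P' M') WState.init).last =
            some (if M' u < P' v then v else u))) := by
  obtain ⟨L₁, L₂, rfl, hu1, hv1, hu2, hv2⟩ := H
  have off : ∀ {K : List ℕ}, u ∉ K → v ∉ K → ∀ t, K.foldl (WState.step P' M') t =
      K.foldl (WState.step P M) t := fun hu hv t =>
    foldl_step_congr (fun h hh => (hP h (by rintro rfl; exact hu hh)
      (by rintro rfl; exact hv hh)).symm) (fun h hh => (hM h (by rintro rfl; exact hu hh)
      (by rintro rfl; exact hv hh)).symm) t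
  simp only [List.foldl_append, List.foldl_cons, off hu1 hv1, off hu2 hv2, step_step]
  rw [← hA, ← hB]
  have hlast := foldl_step_last P M L₁ WState.init
  generalize L₁.foldl (WState.step P M) WState.init = t at hlast ⊢
  have key := foldl_step_of_counts_eq P M L₂
    ⟨t.plus + (P u + (P v - M u) - t.minus),
      (t.minus - (P u + (P v - M u))) + ((M u - P v) + M v),
      if t.minus < P u + (P v - M u) then some (if M u < P v then v else u) else t.last⟩
    ⟨t.plus + (P u + (P v - M u) - t.minus),
      (t.minus - (P u + (P v - M u))) + ((M u - P v) + M v),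
      if t.minus < P u + (P v - M u) then some (if M' u < P' v then v else u) else t.last⟩
    rfl rfl
  obtain ⟨k1, k2, k3⟩ := key
  refine ⟨k1, k2, ?_⟩
  rcases k3 with ⟨k3, h, hh, hl⟩ | ⟨k3, k4⟩
  · refine Or.inl ⟨k3, ?_, ?_⟩ <;> rw [hl] <;> intro hc <;>
      rw [Option.some.injEq] at hc <;> subst hc <;> contradiction
  · by_cases hc : t.minus < P u + (P v - M u)
    · simp only [if_pos hc] at k3 k4 ⊢
      exact Or.inr ⟨k3, k4⟩
    · simp only [if_neg hc] at k3 k4 ⊢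
      refine Or.inl ⟨trivial, ?_, ?_⟩ <;> rw [k3] <;> intro hx <;>
        rcases hlast _ hx with ⟨hx, -⟩ | hx
      · exact hu1 hx
      · simp [WState.init] at hx
      · exact hv1 hx
      · simp [WState.init] at hx

theorem wState_last_pos {n i h : ℕ} {α : KPf} (H : (wState n i α).last = some h) :
    0 < α (h, i) := by
  rcases foldl_step_last _ _ _ _ _ H with ⟨-, H⟩ | H
  · exact H
  · simp [WState.init] at H

theorem wStateS_last_pos {n i m : ℕ} {α : KPf} (H : (wStateS n i α).last = some m) :
    0 < α (i+1, m) := by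
  rcases foldl_step_last _ _ _ _ _ H with ⟨-, H⟩ | H
  · exact H
  · simp [WState.init] at H

theorem wState_congr {n i : ℕ} {α β : KPf}
    (H : ∀ h, α (h, i) = β (h, i) ∧ α (h, i+1) = β (h, i+1)) :
    wState n i α = wState n i β :=
  foldl_step_congr (fun h _ => (H h).1) (fun h _ => (H h).2) _

theorem wStateS_congr {n i : ℕ} {α β : KPf}
    (H : ∀ m, α (i+1, m) = β (i+1, m) ∧ α (i, m) = β (i, m)) :
    wStateS n i α = wStateS n i β :=
  foldl_step_congr (fun m _ => (H m).1) (fun m _ => (H m).2) _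

theorem wState_block {n i j : ℕ} (hi : i + 1 ≤ n) {α β : KPf}
    (H : ∀ h, h ≠ i → h ≠ i+1 → α (h, j) = β (h, j) ∧ α (h, j+1) = β (h, j+1))
    (hA : α (i+1, j) + (α (i, j) - α (i+1, j+1)) = β (i+1, j) + (β (i, j) - β (i+1, j+1)))
    (hB : (α (i+1, j+1) - α (i, j)) + α (i, j+1) =
      (β (i+1, j+1) - β (i, j)) + β (i, j+1)) :
    (wState n j α).plus = (wState n j β).plus ∧ (wState n j α).minus = (wState n j β).minus ∧
      (((wState n j α).last = (wState n j β).last ∧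
          (wState n j α).last ≠ some (i+1) ∧ (wState n j α).last ≠ some i) ∨
        ((wState n j α).last = some (if α (i+1, j+1) < α (i, j) then i else i+1) ∧
          (wState n j β).last = some (if β (i+1, j+1) < β (i, j) then i else i+1))) :=
  (consecutive_range (N := n+1) (by omega)).reverse.foldl_step
    (fun h h1 h2 => (H h h2 h1).1) (fun h h1 h2 => (H h h2 h1).2) hA hB

theorem wStateS_block {n i j : ℕ} (hj : j + 1 ≤ n) {α β : KPf}
    (H : ∀ m, m ≠ j → m ≠ j+1 → α (i+1, m) = β (i+1, m) ∧ α (i, m) = β (i, m))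
    (hA : α (i+1, j) + (α (i+1, j+1) - α (i, j)) = β (i+1, j) + (β (i+1, j+1) - β (i, j)))
    (hB : (α (i, j) - α (i+1, j+1)) + α (i, j+1) =
      (β (i, j) - β (i+1, j+1)) + β (i, j+1)) :
    (wStateS n i α).plus = (wStateS n i β).plus ∧
      (wStateS n i α).minus = (wStateS n i β).minus ∧
      (((wStateS n i α).last = (wStateS n i β).last ∧
          (wStateS n i α).last ≠ some j ∧ (wStateS n i α).last ≠ some (j+1)) ∨
        ((wStateS n i α).last = some (if α (i, j) < α (i+1, j+1) then j+1 else j) ∧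
          (wStateS n i β).last = some (if β (i, j) < β (i+1, j+1) then j+1 else j))) :=
  (consecutive_range (N := n+1) (by omega)).foldl_step
    (fun h h1 h2 => (H h h1 h2).1) (fun h h1 h2 => (H h h1 h2).2) hA hB

theorem KPmove_apply_of_ne (α : KPf) {r r' p : Root} (h : p ≠ r) (h' : p ≠ r') :
    KPmove α r r' p = α p := by
  simp [KPmove, KPadd, KPsub, h, h']

theorem KPmove_apply (α : KPf) {r r' : Root} (p : Root) :
    KPmove α r r' p = α p - (if p = r then 1 else 0) + (if p = r' then 1 else 0) := by
  unfold KPmove KPadd KPsub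
  split_ifs <;> omega

theorem KPmove_comm (α : KPf) {r r' q q' : Root} (h1 : r ≠ q) (h2 : r ≠ q') (h3 : r' ≠ q) :
    KPmove (KPmove α r r') q q' = KPmove (KPmove α q q') r r' := by
  funext p
  simp only [KPmove_apply]
  split_ifs <;> simp_all

theorem wState_KPmove_star {n i j m : ℕ} (hi : i + 1 ≤ n) (hj : j + 1 ≤ n) {α : KPf}
    (hm : (wStateS n i α).last = some m) :
    (wState n j α).plus = (wState n j (KPmove α (i+1, m) (i, m))).plus ∧
      ((wState n j α).last = (wState n j (KPmove α (i+1, m) (i, m))).last ∧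
          (m = j ∨ m = j+1 → (wState n j α).last ≠ some (i+1) ∧ (wState n j α).last ≠ some i) ∨
        m = (if α (i, j) < α (i+1, j+1) then j+1 else j) ∧
        (wState n j α).last = some (if α (i+1, j+1) < α (i, j) then i else i+1) ∧
        (wState n j (KPmove α (i+1, m) (i, m))).last =
          some (if KPmove α (i+1, m) (i, m) (i+1, j+1) < KPmove α (i+1, m) (i, m) (i, j)
            then i else i+1)) := by
  have hpos := wStateS_last_pos hm
  by_cases hmj : m = j ∨ m = j+1
  · obtain ⟨-, -, ⟨-, h1, h2⟩ | ⟨h1, -⟩⟩ :=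
      wStateS_block (i := i) (α := α) (β := α) hj (by simp) rfl rfl
    · rcases hmj with rfl | rfl <;> contradiction
    · have hmif := Option.some.inj (hm.symm.trans h1)
      have key := wState_block (n := n) (j := j) hi (α := α) (β := KPmove α (i+1, m) (i, m))
        (fun h h1 h2 => by simp [KPmove_apply, h1, h2])
        (by split_ifs at hmif <;> subst hmif <;> simp [KPmove_apply] <;> omega)
        (by split_ifs at hmif <;> subst hmif <;> simp [KPmove_apply] <;> omega)
      obtain ⟨k1, -, ⟨k2, k3, k4⟩ | ⟨k2, k3⟩⟩ := key
      · exact ⟨k1, Or.inl ⟨k2, fun _ => ⟨k3, k4⟩⟩⟩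
      · exact ⟨k1, Or.inr ⟨hmif, k2, k3⟩⟩
  · rw [← wState_congr (n := n) (i := j) (α := α) (β := KPmove α (i+1, m) (i, m))]
    · exact ⟨rfl, Or.inl ⟨rfl, fun h => absurd h hmj⟩⟩
    · intro h
      push Not at hmj
      simp [KPmove_apply, hmj.1.symm, hmj.2.symm]

theorem wStateS_KPmove {n i j h : ℕ} (hi : i + 1 ≤ n) (hj : j + 1 ≤ n) {α : KPf}
    (hh : (wState n j α).last = some h) :
    (wStateS n i α).minus = (wStateS n i (KPmove α (h, j) (h, j+1))).minus ∧
      ((wStateS n i α).last = (wStateS n i (KPmove α (h, j) (h, j+1))).last ∧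
          (h = i ∨ h = i+1 → (wStateS n i α).last ≠ some j ∧
            (wStateS n i α).last ≠ some (j+1)) ∨
        h = (if α (i+1, j+1) < α (i, j) then i else i+1) ∧
        (wStateS n i α).last = some (if α (i, j) < α (i+1, j+1) then j+1 else j) ∧
        (wStateS n i (KPmove α (h, j) (h, j+1))).last =
          some (if KPmove α (h, j) (h, j+1) (i, j) < KPmove α (h, j) (h, j+1) (i+1, j+1)
            then j+1 else j)) := by
  have hpos := wState_last_pos hh
  by_cases hhi : h = i ∨ h = i+1
  · obtain ⟨-, -, ⟨-, h1, h2⟩ | ⟨h1, -⟩⟩ :=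
      wState_block (j := j) (α := α) (β := α) hi (by simp) rfl rfl
    · rcases hhi with rfl | rfl <;> contradiction
    · have hhif := Option.some.inj (hh.symm.trans h1)
      have key := wStateS_block (n := n) (i := i) hj (α := α) (β := KPmove α (h, j) (h, j+1))
        (fun h h1 h2 => by simp [KPmove_apply, h1, h2])
        (by split_ifs at hhif <;> subst hhif <;> simp [KPmove_apply] <;> omega)
        (by split_ifs at hhif <;> subst hhif <;> simp [KPmove_apply] <;> omega)
      obtain ⟨-, k1, ⟨k2, k3, k4⟩ | ⟨k2, k3⟩⟩ := key
      · exact ⟨k1, Or.inl ⟨k2, fun _ => ⟨k3, k4⟩⟩⟩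
      · exact ⟨k1, Or.inr ⟨hhif, k2, k3⟩⟩
  · rw [← wStateS_congr (n := n) (i := i) (α := α) (β := KPmove α (h, j) (h, j+1))]
    · exact ⟨rfl, Or.inl ⟨rfl, fun h => absurd h hhi⟩⟩
    · intro m
      push Not at hhi
      simp [KPmove_apply, hhi.1.symm, hhi.2.symm]

/-- Pairs of successive moves within `S` agree as soon as they agree on `S`. -/
theorem KPmove_KPmove_congr {α : KPf} {r₁ r₂ r₃ r₄ q₁ q₂ q₃ q₄ : Root} (S : Set Root)
    (hr : r₁ ∈ S ∧ r₂ ∈ S ∧ r₃ ∈ S ∧ r₄ ∈ S) (hq : q₁ ∈ S ∧ q₂ ∈ S ∧ q₃ ∈ S ∧ q₄ ∈ S)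
    (H : ∀ p ∈ S, KPmove (KPmove α r₁ r₂) r₃ r₄ p = KPmove (KPmove α q₁ q₂) q₃ q₄ p) :
    KPmove (KPmove α r₁ r₂) r₃ r₄ = KPmove (KPmove α q₁ q₂) q₃ q₄ := by
  funext p
  by_cases hp : p ∈ S
  · exact H p hp
  · have : ∀ x ∈ S, p ≠ x := fun x hx hpx => hp (hpx ▸ hx)
    simp [KPmove_apply, this _ hr.1, this _ hr.2.1, this _ hr.2.2.1, this _ hr.2.2.2,
      this _ hq.1, this _ hq.2.1, this _ hq.2.2.1, this _ hq.2.2.2]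

/-- The moves of `f̃_i*` and `f̃_j` commute. -/
theorem KPmove_star_diamond {n i j m h : ℕ} (hi : i + 1 ≤ n) (hj : j + 1 ≤ n) {α : KPf}
    (hm : (wStateS n i α).last = some m) (hh : (wState n j α).last = some h) :
    ∃ h' m', (wState n j (KPmove α (i+1, m) (i, m))).last = some h' ∧
      (wStateS n i (KPmove α (h, j) (h, j+1))).last = some m' ∧
      KPmove (KPmove α (i+1, m) (i, m)) (h', j) (h', j+1) =
        KPmove (KPmove α (h, j) (h, j+1)) (i+1, m') (i, m') := by
  have hpm := wStateS_last_pos hm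
  have hph := wState_last_pos hh
  rcases (wState_KPmove_star hi hj hm).2 with ⟨k1, k2⟩ | ⟨k1, k2, k3⟩
  · rcases (wStateS_KPmove hi hj hh).2 with ⟨l1, -⟩ | ⟨l1, l2, -⟩
    · refine ⟨h, m, k1.symm.trans hh, l1.symm.trans hm, ?_⟩
      have hne : (m = j ∨ m = j+1) → h ≠ i+1 ∧ h ≠ i := by simpa [hh] using k2
      refine KPmove_comm α ?_ ?_ ?_ <;> rw [Ne, Prod.mk.injEq] <;> omega
    · rw [hh, l1] at k2
      rw [hm, Option.some.injEq] at l2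
      split_ifs at k2 l2 <;> simp_all
  · rcases (wStateS_KPmove hi hj hh).2 with ⟨l1, l2⟩ | ⟨l1, l2, l3⟩
    · rw [hm, k1] at l2
      rw [hh, Option.some.injEq] at k2
      split_ifs at k2 l2 <;> simp_all
    · refine ⟨_, _, k3, l3, ?_⟩
      rcases lt_trichotomy (α (i+1, j+1)) (α (i, j)) with hc | hc | hc
      · rw [if_neg (by omega)] at k1
        rw [if_pos hc] at l1
        rw [k1] at hpm ⊢
        rw [l1] at hph ⊢
        rw [if_pos (by simp [KPmove_apply]; omega), if_neg (by simp [KPmove_apply]; omega)]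
        refine KPmove_KPmove_congr {(i+1, j), (i+1, j+1), (i, j), (i, j+1)} (by simp) (by simp) ?_
        rintro p (rfl | rfl | rfl | rfl) <;> simp [KPmove_apply] <;> omega
      · rw [if_neg (by omega)] at k1
        rw [if_neg (by omega)] at l1
        rw [k1] at hpm ⊢
        rw [l1] at hph ⊢
        rw [if_pos (by simp [KPmove_apply]; omega), if_pos (by simp [KPmove_apply]; omega)]
        refine KPmove_KPmove_congr {(i+1, j), (i+1, j+1), (i, j), (i, j+1)} (by simp) (by simp) ?_
        rintro p (rfl | rfl | rfl | rfl) <;> simp [KPmove_apply]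
      · rw [if_pos (by omega)] at k1
        rw [if_neg (by omega)] at l1
        rw [k1] at hpm ⊢
        rw [l1] at hph ⊢
        rw [if_neg (by simp [KPmove_apply]; omega), if_pos (by simp [KPmove_apply]; omega)]
        refine KPmove_KPmove_congr {(i+1, j), (i+1, j+1), (i, j), (i, j+1)} (by simp) (by simp) ?_
        rintro p (rfl | rfl | rfl | rfl) <;> simp [KPmove_apply] <;> omega

theorem IsKP.KPmove {n : ℕ} {α : KPf} (hα : IsKP n α) {r r' : Root} (hr' : IsPos n r') :
    IsKP n (KPmove α r r') := by
  intro p hp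
  by_cases h : p = r'
  · exact h ▸ hr'
  · refine hα p fun h0 => hp ?_
    simp [KPmove_apply, h0, h]

theorem IsKP.fop {n i : ℕ} (hi1 : 1 ≤ i) (hi : i + 1 ≤ n) {α β : KPf} (hα : IsKP n α)
    (h : fop n i α = some β) : IsKP n β := by
  rcases (fop_eq_some_iff n i α β).1 h with ⟨-, h, hl, rfl⟩ | ⟨-, m, hl, rfl⟩
  · obtain ⟨h1, h2, h3⟩ := hα _ (wState_last_pos hl).ne'
    exact hα.KPmove ⟨h1, by simp only at h2 ⊢; omega, hi⟩
  · obtain ⟨h1, h2, h3⟩ := hα _ (wStateS_last_pos hl).ne'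
    exact hα.KPmove ⟨hi1, by simp only at h2 ⊢; omega, h3⟩

theorem fop_diamond_of_lt {n i j : ℕ} (hij : i + 1 < j) (hj : j + 1 ≤ n)
    {α β γ : KPf} (hα : IsKP n α) (hβ : fop n i α = some β) (hγ : fop n j α = some γ) :
    ∃ δ, fop n j β = some δ ∧ fop n i γ = some δ := by
  have hi : i + 1 ≤ n := by omega
  simp only [fop_eq_some_iff] at hβ hγ ⊢
  have pos {p : Root} (hp : 0 < α p) : p.1 < p.2 := (hα p hp.ne').2.1
  rcases hβ with ⟨ci, h, hl, rfl⟩ | ⟨ci, m, hm, rfl⟩ <;>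
    rcases hγ with ⟨cj, h', hl', rfl⟩ | ⟨cj, m', hm', rfl⟩
  · have b1 := pos (wState_last_pos hl)
    have e1 : wState n j (KPmove α (h, i) (h, i+1)) = wState n j α :=
      wState_congr fun x => by constructor <;> apply KPmove_apply_of_ne <;> grind
    have e2 : wStateS n j (KPmove α (h, i) (h, i+1)) = wStateS n j α :=
      wStateS_congr fun x => by constructor <;> apply KPmove_apply_of_ne <;> grind
    have e3 : wState n i (KPmove α (h', j) (h', j+1)) = wState n i α :=
      wState_congr fun x => by constructor <;> apply KPmove_apply_of_ne <;> grind
    have e4 := (wStateS_KPmove hi hj hl').1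
    refine ⟨_, Or.inl ⟨by rwa [e1, e2], h', by rwa [e1], rfl⟩,
      Or.inl ⟨by rwa [e3, ← e4], h, by rwa [e3], ?_⟩⟩
    apply KPmove_comm <;> grind
  · have b1 := pos (wState_last_pos hl)
    have b2 := pos (wStateS_last_pos hm')
    have e1 : wState n j (KPmove α (h, i) (h, i+1)) = wState n j α :=
      wState_congr fun x => by constructor <;> apply KPmove_apply_of_ne <;> grind
    have e2 : wStateS n j (KPmove α (h, i) (h, i+1)) = wStateS n j α :=
      wStateS_congr fun x => by constructor <;> apply KPmove_apply_of_ne <;> grind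
    have e3 : wState n i (KPmove α (j+1, m') (j, m')) = wState n i α :=
      wState_congr fun x => by constructor <;> apply KPmove_apply_of_ne <;> grind
    have e4 : wStateS n i (KPmove α (j+1, m') (j, m')) = wStateS n i α :=
      wStateS_congr fun x => by constructor <;> apply KPmove_apply_of_ne <;> grind
    refine ⟨_, Or.inr ⟨by rwa [e1, e2], m', by rwa [e2], rfl⟩,
      Or.inl ⟨by rwa [e3, e4], h, by rwa [e3], ?_⟩⟩
    apply KPmove_comm <;> grind
  · have e2 : wStateS n j (KPmove α (i+1, m) (i, m)) = wStateS n j α :=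
      wStateS_congr fun x => by constructor <;> apply KPmove_apply_of_ne <;> grind
    have e3 : wState n i (KPmove α (h', j) (h', j+1)) = wState n i α :=
      wState_congr fun x => by constructor <;> apply KPmove_apply_of_ne <;> grind
    have e1 := (wState_KPmove_star hi hj hm).1
    have e4 := (wStateS_KPmove hi hj hl').1
    obtain ⟨h'', m'', k1, k2, k3⟩ := KPmove_star_diamond hi hj hm hl'
    exact ⟨_, Or.inl ⟨by rwa [← e1, e2], h'', k1, rfl⟩, Or.inr ⟨by rwa [e3, ← e4], m'', k2, k3⟩⟩
  · have b2 := pos (wStateS_last_pos hm')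
    have e2 : wStateS n j (KPmove α (i+1, m) (i, m)) = wStateS n j α :=
      wStateS_congr fun x => by constructor <;> apply KPmove_apply_of_ne <;> grind
    have e3 : wState n i (KPmove α (j+1, m') (j, m')) = wState n i α :=
      wState_congr fun x => by constructor <;> apply KPmove_apply_of_ne <;> grind
    have e4 : wStateS n i (KPmove α (j+1, m') (j, m')) = wStateS n i α :=
      wStateS_congr fun x => by constructor <;> apply KPmove_apply_of_ne <;> grind
    have e1 := (wState_KPmove_star hi hj hm).1
    refine ⟨_, Or.inr ⟨by rwa [← e1, e2], m', by rwa [e2], rfl⟩,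
      Or.inr ⟨by rwa [e3, e4], m, by rwa [e4], ?_⟩⟩
    apply KPmove_comm <;> grind

theorem fop_diamond {n i j : ℕ} (hij : i + 1 < j ∨ j + 1 < i) (hi : i + 1 ≤ n) (hj : j + 1 ≤ n)
    {α β γ : KPf} (hα : IsKP n α) (hβ : fop n i α = some β) (hγ : fop n j α = some γ) :
    ∃ δ, fop n j β = some δ ∧ fop n i γ = some δ := by
  rcases hij with hij | hij
  · exact fop_diamond_of_lt hij hj hα hβ hγ
  · obtain ⟨δ, h1, h2⟩ := fop_diamond_of_lt hij hi hα hγ hβ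
    exact ⟨δ, h2, h1⟩

/-- A local diamond for two partial operators preserving `p` fills in the whole rectangle. -/
theorem iterO_diamond {f g : KPf → Option KPf} {p : KPf → Prop}
    (hf : ∀ x y, p x → f x = some y → p y) (hg : ∀ x y, p x → g x = some y → p y)
    (H : ∀ x y z, p x → f x = some y → g x = some z → ∃ t, g y = some t ∧ f z = some t)
    (a b : ℕ) {x y z : KPf} (hx : p x) (hy : iterO f a x = some y) (hz : iterO g b x = some z) :
    ∃ t, iterO g b y = some t ∧ iterO f a z = some t := by
  have strip : ∀ (b : ℕ) (x y z : KPf), p x → f x = some y → iterO g b x = some z →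
      ∃ t, iterO g b y = some t ∧ f z = some t := by
    intro b
    induction b with
    | zero =>
      intro x y z _ hy hz
      cases hz
      exact ⟨y, rfl, hy⟩
    | succ b ih =>
      intro x y z hx hy hz
      obtain ⟨z', hz', hz⟩ := Option.bind_eq_some_iff.1 hz
      obtain ⟨t', ht, ht'⟩ := H x y z' hx hy hz'
      obtain ⟨t, h1, h2⟩ := ih z' t' z (hg _ _ hx hz') ht' hz
      exact ⟨t, Option.bind_eq_some_iff.2 ⟨t', ht, h1⟩, h2⟩
  induction a generalizing x z with
  | zero =>
    cases hy
    exact ⟨z, hz, rfl⟩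
  | succ a ih =>
    obtain ⟨y', hy', hy⟩ := Option.bind_eq_some_iff.1 hy
    obtain ⟨z', hz', hfz⟩ := strip b x y' z hx hy' hz
    obtain ⟨t, h1, h2⟩ := ih (hf _ _ hx hy') hy hz'
    exact ⟨t, h1, Option.bind_eq_some_iff.2 ⟨z', hfz, h2⟩⟩

end KFC

open KFC in
/-- Braid relation (commuting case) for the `Φ` operators built from `f`:
if `|i−j| > 1`, `k_i, k_j < 0` and both `f_i^{−k_i}(α)`, `f_j^{−k_j}(α)` are
nonzero, then `f_i^{−k_i}(f_j^{−k_j}(α)) = f_j^{−k_j}(f_i^{−k_i}(α)) ≠ 0`. -/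
theorem stmt5 (n : ℕ) (hn : 2 ≤ n) (lam mu : ℕ → ℤ)
    (hlam : ∀ k, 1 ≤ k → k < n → lam (k+1) ≤ lam k) (hlamn : lam n = 0)
    (hmu : ∀ k, 1 ≤ k → k < n → mu (k+1) ≤ mu k) (hmun : 0 ≤ mu n)
    (hcomb : ∃ c : ℕ → ℕ, c 0 = 0 ∧ c n = 0 ∧
      ∀ k, 1 ≤ k → k ≤ n → lam k - mu k = (c k : ℤ) - (c (k-1) : ℤ))
    (w : Equiv.Perm (Fin n)) (α : KPf) (hwα : InS n lam mu w α) (i j : ℕ)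
    (hi1 : 1 ≤ i) (hi2 : i ≤ n - 1) (hj1 : 1 ≤ j) (hj2 : j ≤ n - 1)
    (hij : i + 1 < j ∨ j + 1 < i)
    (ki kj : ℤ)
    (hki : ki = pairCo (permAct n w (lamRho n lam)) i)
    (hkj : kj = pairCo (permAct n w (lamRho n lam)) j)
    (hki0 : ki < 0) (hkj0 : kj < 0)
    (hfi : iterO (fop n i) (-ki).toNat α ≠ none)
    (hfj : iterO (fop n j) (-kj).toNat α ≠ none) :
    (iterO (fop n j) (-kj).toNat α).bind (iterO (fop n i) (-ki).toNat) =
      (iterO (fop n i) (-ki).toNat α).bind (iterO (fop n j) (-kj).toNat) ∧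
    (iterO (fop n j) (-kj).toNat α).bind (iterO (fop n i) (-ki).toNat) ≠ none := by
  obtain ⟨β, hβ⟩ := Option.ne_none_iff_exists'.1 hfi
  obtain ⟨γ, hγ⟩ := Option.ne_none_iff_exists'.1 hfj
  obtain ⟨δ, h1, h2⟩ := iterO_diamond (p := IsKP n) (fun _ _ h => h.fop hi1 (by omega))
    (fun _ _ h => h.fop hj1 (by omega))
    (fun _ _ _ h => fop_diamond hij (by omega) (by omega) h) _ _ hwα.1 hβ hγ
  simp [hβ, hγ, h1, h2]
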